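/- arXiv:2502.18069 — 3 statements merged into one kernel-verified Lean document; each statement's English description precedes it below -/
import Mathlib

section
/- Let C = aC_a ⊕ bC_b be a linear code of length n over H_32, where C_a is a binary linear code and C_b a ternary linear code. Then C is quasi self-dual if and only if C_a is a binary code of dimension n/2 (equivalently |C_a| = 2^{n/2}) and C_b is a self-dual ternary code. -/
/-!
Common setup: the non-unital rings `H₂₃` and `H₃₂` of order 6, whose common
additive group is `ZMod 2 × ZMod 3`, and codes over them.
-/

/-- The common additive group of the rings `H₂₃` and `H₃₂`. -/
abbrev Hring : Type := ZMod 2 × ZMod 3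

/-- The element `a = (1,0)` of `H`. -/
def aH : Hring := (1, 0)

/-- The element `b = (0,1)` of `H`. -/
def bH : Hring := (0, 1)

/-- Multiplication of the non-unital ring `H₂₃`: `(x₁,y₁)·(x₂,y₂) = (x₁x₂, 0)`. -/
def mul23 (u v : Hring) : Hring := (u.1 * v.1, 0)

/-- Multiplication of the non-unital ring `H₃₂`: `(x₁,y₁)·(x₂,y₂) = (0, y₁y₂)`. -/
def mul32 (u v : Hring) : Hring := (0, u.2 * v.2)

/-- The vector `a·x` associated with a binary vector `x`:
`(a·x)_j = a` if `x_j = 1` and `0` otherwise, i.e. `(a·x)_j = (x_j, 0)`. -/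
def aVec {n : ℕ} (x : Fin n → ZMod 2) : Fin n → Hring := fun j => (x j, 0)

/-- The vector `b·y` associated with a ternary vector `y`:
`(b·y)_j = 0, b, 2b` according as `y_j = 0, 1, 2`, i.e. `(b·y)_j = (0, y_j)`. -/
def bVec {n : ℕ} (y : Fin n → ZMod 3) : Fin n → Hring := fun j => (0, y j)

/-- The code `a C_a ⊕ b C_b = {a·x + b·y : x ∈ C_a, y ∈ C_b}` over `H`. -/
def combCode {n : ℕ} (Ca : Set (Fin n → ZMod 2)) (Cb : Set (Fin n → ZMod 3)) :
    Set (Fin n → Hring) :=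
  { c | ∃ x ∈ Ca, ∃ y ∈ Cb, c = aVec x + bVec y }

/-- Inner product on `H^n` with respect to the multiplication `mul`. -/
def innerH {n : ℕ} (mul : Hring → Hring → Hring) (x y : Fin n → Hring) : Hring :=
  ∑ i, mul (x i) (y i)

/-- Standard inner product on `F^n`. -/
def innerF {F : Type*} [CommRing F] {n : ℕ} (x y : Fin n → F) : F :=
  ∑ i, x i * y i

/-- Dual of a code in `H^n` with respect to the multiplication `mul`. -/
def dualH {n : ℕ} (mul : Hring → Hring → Hring) (C : Set (Fin n → Hring)) :
    Set (Fin n → Hring) :=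
  { y | ∀ x ∈ C, innerH mul x y = 0 }

/-- Dual of a code in `F^n` with respect to the standard inner product. -/
def dualF {F : Type*} [CommRing F] {n : ℕ} (C : Set (Fin n → F)) : Set (Fin n → F) :=
  { y | ∀ x ∈ C, innerF x y = 0 }

/-- A linear code over `(H, mul)`: a nonempty subset of `H^n` closed under
componentwise addition and under (componentwise) multiplication by each ring element. -/
def IsLinearCode {n : ℕ} (mul : Hring → Hring → Hring) (C : Set (Fin n → Hring)) : Prop :=
  C.Nonempty ∧ (∀ u ∈ C, ∀ v ∈ C, u + v ∈ C) ∧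
    ∀ r : Hring, ∀ u ∈ C, (fun i => mul r (u i)) ∈ C

/-- Self-orthogonality of a code in `H^n`. -/
def SelfOrthH {n : ℕ} (mul : Hring → Hring → Hring) (C : Set (Fin n → Hring)) : Prop :=
  ∀ x ∈ C, ∀ y ∈ C, innerH mul x y = 0

/-- Self-orthogonality of a code over a finite field. -/
def SelfOrthF {F : Type*} [CommRing F] {n : ℕ} (C : Set (Fin n → F)) : Prop :=
  ∀ x ∈ C, ∀ y ∈ C, innerF x y = 0

/-- A quasi self-dual (QSD) code: self-orthogonal with `|C| = 6^(n/2)`. -/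
def QSD {n : ℕ} (mul : Hring → Hring → Hring) (C : Set (Fin n → Hring)) : Prop :=
  SelfOrthH mul C ∧ (Nat.card C : ℝ) = (6 : ℝ) ^ ((n : ℝ) / 2)

/-- Hamming weight: the number of nonzero coordinates. -/
def wt {β : Type*} [Zero β] [DecidableEq β] {n : ℕ} (v : Fin n → β) : ℕ :=
  (Finset.univ.filter (fun i => v i ≠ 0)).card

/-- `d` is the minimum distance of the code `C`: `d` is the least Hamming weight of a
nonzero codeword. -/
def IsMinDist {β : Type*} [Zero β] [DecidableEq β] {n : ℕ}
    (C : Set (Fin n → β)) (d : ℕ) : Prop :=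
  (∃ v ∈ C, v ≠ 0 ∧ wt v = d) ∧ ∀ v ∈ C, v ≠ 0 → d ≤ wt v

/-- A code is cyclic if it is closed under the cyclic shift
`(c₁, …, c_n) ↦ (c_n, c₁, …, c_{n-1})`. -/
def IsCyclicCode {β : Type*} {n : ℕ} (C : Set (Fin n → β)) : Prop :=
  ∀ c ∈ C, (fun i : Fin n => c ((finRotate n).symm i)) ∈ C

/-- The linear code over `(H, mul)` generated by a set `S` of vectors: the smallest
linear code containing `S`. -/
def genCode {n : ℕ} (mul : Hring → Hring → Hring) (S : Set (Fin n → Hring)) :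
    Set (Fin n → Hring) :=
  ⋂₀ { C | IsLinearCode mul C ∧ S ⊆ C }

theorem aux_half (X c : ℝ) (hX : 0 ≤ X) (hc : 0 ≤ c) (n : ℕ) :
    X = c ^ ((n : ℝ) / 2) ↔ X ^ 2 = c ^ n := by
  have h : (c ^ ((n : ℝ) / 2)) ^ 2 = c ^ n := by
    rw [← Real.rpow_natCast, ← Real.rpow_mul hc]
    norm_num
  rw [← h]
  exact (pow_left_inj₀ hX (Real.rpow_nonneg hc _) (by norm_num)).symm

theorem aux_two (k n : ℕ) : (((2 ^ k : ℕ)) : ℝ) = (2 : ℝ) ^ ((n : ℝ) / 2) ↔ 2 * k = n := by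
  rw [aux_half _ _ (by positivity) (by norm_num)]
  norm_cast
  rw [← pow_mul, mul_comm k 2]
  exact Nat.pow_right_inj (le_refl 2)

theorem aux_six (k l n : ℕ) : (((2 ^ k * 3 ^ l : ℕ)) : ℝ) = (6 : ℝ) ^ ((n : ℝ) / 2) ↔
    2 * k = n ∧ 2 * l = n := by
  rw [aux_half _ _ (by positivity) (by norm_num)]
  norm_cast
  constructor
  · intro h
    have h6 : (6 : ℕ) = 2 * 3 := rfl
    rw [mul_pow, ← pow_mul, ← pow_mul, h6, mul_pow] at h
    have f2 := congrArg (fun m => m.factorization 2) h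
    have f3 := congrArg (fun m => m.factorization 3) h
    simp [Nat.factorization_mul, Nat.factorization_pow, Nat.prime_two.factorization,
      Nat.prime_three.factorization] at f2 f3
    omega
  · rintro ⟨rfl, h⟩
    have : l = k := by omega
    subst this
    rw [← mul_pow, ← pow_mul, mul_comm l 2]
    norm_num

theorem card_comb {n : ℕ}
    (Ca : Submodule (ZMod 2) (Fin n → ZMod 2)) (Cb : Submodule (ZMod 3) (Fin n → ZMod 3)) :
    Nat.card (combCode (Ca : Set (Fin n → ZMod 2)) (Cb : Set (Fin n → ZMod 3))) =
      2 ^ Module.finrank (ZMod 2) Ca * 3 ^ Module.finrank (ZMod 3) Cb := by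
  have e : Nat.card (Ca × Cb) =
      Nat.card (combCode (Ca : Set (Fin n → ZMod 2)) (Cb : Set (Fin n → ZMod 3))) := by
    refine Nat.card_eq_of_bijective
      (fun p => ⟨aVec p.1.1 + bVec p.2.1, p.1.1, p.1.2, p.2.1, p.2.2, rfl⟩) ⟨?_, ?_⟩
    · rintro ⟨⟨x, hx⟩, ⟨y, hy⟩⟩ ⟨⟨x', hx'⟩, ⟨y', hy'⟩⟩ h
      have h' := congrArg Subtype.val h
      have hxx : x = x' := by
        funext i
        simpa [aVec, bVec] using congrArg Prod.fst (congrFun h' i)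
      have hyy : y = y' := by
        funext i
        simpa [aVec, bVec] using congrArg Prod.snd (congrFun h' i)
      subst hxx hyy
      rfl
    · rintro ⟨c, x, hx, y, hy, rfl⟩
      exact ⟨⟨⟨x, hx⟩, ⟨y, hy⟩⟩, rfl⟩
  rw [← e, Nat.card_prod, Module.natCard_eq_pow_finrank (K := ZMod 2) (V := Ca),
    Module.natCard_eq_pow_finrank (K := ZMod 3) (V := Cb), Nat.card_zmod, Nat.card_zmod]

theorem innerH_comb {n : ℕ} (x x' : Fin n → ZMod 2) (y y' : Fin n → ZMod 3) :
    innerH mul32 (aVec x + bVec y) (aVec x' + bVec y') = (0, innerF y y') := by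
  unfold innerH innerF mul32 aVec bVec
  ext <;> simp [Prod.fst_sum, Prod.snd_sum]

theorem selfOrth_comb {n : ℕ}
    (Ca : Submodule (ZMod 2) (Fin n → ZMod 2)) (Cb : Submodule (ZMod 3) (Fin n → ZMod 3)) :
    SelfOrthH mul32 (combCode (Ca : Set (Fin n → ZMod 2)) (Cb : Set (Fin n → ZMod 3))) ↔
      SelfOrthF (Cb : Set (Fin n → ZMod 3)) := by
  constructor
  · intro h y hy y' hy'
    have := h _ ⟨0, Ca.zero_mem, y, hy, rfl⟩ _ ⟨0, Ca.zero_mem, y', hy', rfl⟩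
    rw [innerH_comb] at this
    exact congrArg Prod.snd this
  · rintro h _ ⟨x, hx, y, hy, rfl⟩ _ ⟨x', hx', y', hy', rfl⟩
    rw [innerH_comb, h y hy y' hy']
    rfl

/-- A code is self-dual iff it is self-orthogonal of half dimension. -/
theorem selfDual_iff {n : ℕ} (Cb : Submodule (ZMod 3) (Fin n → ZMod 3)) :
    (Cb : Set (Fin n → ZMod 3)) = dualF (Cb : Set (Fin n → ZMod 3)) ↔
      SelfOrthF (Cb : Set (Fin n → ZMod 3)) ∧ 2 * Module.finrank (ZMod 3) Cb = n := by
  let B : LinearMap.BilinForm (ZMod 3) (Fin n → ZMod 3) := dotProductBilin (ZMod 3) (ZMod 3)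
  have hker : LinearMap.ker B = ⊥ := by
    rw [LinearMap.ker_eq_bot']
    intro v hv
    exact dotProduct_eq_zero v fun w => LinearMap.congr_fun hv w
  have hdim := LinearMap.BilinForm.finrank_add_finrank_orthogonal' (B := B) Cb
  rw [hker, inf_bot_eq, finrank_bot, add_zero, Module.finrank_fin_fun] at hdim
  have hdual : dualF (Cb : Set (Fin n → ZMod 3)) = (B.orthogonal Cb : Set (Fin n → ZMod 3)) :=
    rfl
  constructor
  · intro h
    refine ⟨fun x hx y hy => ?_, ?_⟩
    · rw [h] at hy
      exact hy x hx
    · rw [hdual, SetLike.coe_set_eq] at h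
      rw [← h] at hdim
      omega
  · rintro ⟨hso, hd⟩
    rw [hdual, SetLike.coe_set_eq]
    refine Submodule.eq_of_le_of_finrank_eq (fun y hy x hx => hso x hx y hy) ?_
    omega

/-- A code `C = a C_a ⊕ b C_b` over `H₃₂` is quasi self-dual iff
`C_a` has `2^(n/2)` elements (i.e. is an `[n, n/2]` binary code) and `C_b` is a
self-dual ternary code. -/
theorem qsd_iff_H32 {n : ℕ}
    (Ca : Submodule (ZMod 2) (Fin n → ZMod 2)) (Cb : Submodule (ZMod 3) (Fin n → ZMod 3)) :
    QSD mul32 (combCode (Ca : Set (Fin n → ZMod 2)) (Cb : Set (Fin n → ZMod 3))) ↔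
      ((Nat.card Ca : ℝ) = (2 : ℝ) ^ ((n : ℝ) / 2) ∧
        (Cb : Set (Fin n → ZMod 3)) = dualF (Cb : Set (Fin n → ZMod 3))) := by
  unfold QSD
  rw [selfOrth_comb, card_comb, aux_six, selfDual_iff,
    Module.natCard_eq_pow_finrank (K := ZMod 2) (V := Ca), Nat.card_zmod, aux_two]
  tauto
end

section
/- Let C = aC_a ⊕ bC_b be a linear code of length n over H_23, where C_a is a binary linear code and C_b a ternary linear code. Then C is self-dual (C = C^⊥) if and only if C_a is a self-dual binary code and C_b = 𝔽_3^n. -/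
theorem mem_combCode_H {n : ℕ} (A : Set (Fin n → ZMod 2)) (B : Set (Fin n → ZMod 3))
    (c : Fin n → Hring) :
    c ∈ combCode A B ↔ (fun i => (c i).1) ∈ A ∧ (fun i => (c i).2) ∈ B := by
  constructor
  · rintro ⟨x, hx, y, hy, rfl⟩
    simpa [aVec, bVec] using And.intro hx hy
  · rintro ⟨hx, hy⟩
    refine ⟨_, hx, _, hy, ?_⟩
    funext i
    simp [aVec, bVec]

theorem innerH_mul23 {n : ℕ} (x y : Fin n → Hring) :
    innerH mul23 x y = (innerF (fun i => (x i).1) (fun i => (y i).1), 0) := by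
  unfold innerH innerF mul23
  ext
  · simp [Prod.fst_sum]
  · simp [Prod.snd_sum]

theorem mem_dualH_comb {n : ℕ} (Ca : Submodule (ZMod 2) (Fin n → ZMod 2))
    (Cb : Submodule (ZMod 3) (Fin n → ZMod 3)) (c : Fin n → Hring) :
    c ∈ dualH mul23 (combCode (Ca : Set (Fin n → ZMod 2)) (Cb : Set (Fin n → ZMod 3))) ↔
      (fun i => (c i).1) ∈ dualF (Ca : Set (Fin n → ZMod 2)) := by
  constructor
  · intro h x hx
    have h2 := h (fun i => (x i, 0)) ((mem_combCode_H _ _ _).2 ⟨hx, Cb.zero_mem⟩)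
    rw [innerH_mul23] at h2
    exact congrArg Prod.fst h2
  · intro h x hx
    rw [innerH_mul23, h _ ((mem_combCode_H _ _ _).1 hx).1]
    rfl

/-- A code `C = a C_a ⊕ b C_b` over `H₂₃` is self-dual iff
`C_a` is a self-dual binary code and `C_b = 𝔽₃ⁿ`. -/
theorem selfDual_iff_H23 {n : ℕ}
    (Ca : Submodule (ZMod 2) (Fin n → ZMod 2)) (Cb : Submodule (ZMod 3) (Fin n → ZMod 3)) :
    combCode (Ca : Set (Fin n → ZMod 2)) (Cb : Set (Fin n → ZMod 3)) =
        dualH mul23 (combCode (Ca : Set (Fin n → ZMod 2)) (Cb : Set (Fin n → ZMod 3))) ↔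
      ((Ca : Set (Fin n → ZMod 2)) = dualF (Ca : Set (Fin n → ZMod 2)) ∧
        (Cb : Set (Fin n → ZMod 3)) = Set.univ) := by
  constructor
  · intro h
    have key : ∀ c : Fin n → Hring, _ ↔ _ := fun c =>
      (mem_combCode_H _ _ c).symm.trans ((Set.ext_iff.1 h c).trans (mem_dualH_comb Ca Cb c))
    constructor
    · ext x
      have hk := key (fun i => (x i, 0))
      exact ⟨fun hx => hk.1 ⟨hx, Cb.zero_mem⟩, fun hx => (hk.2 hx).1⟩
    · refine Set.eq_univ_of_forall fun y => ?_
      refine ((key (fun i => (0, y i))).2 ?_).2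
      intro x _
      simp [innerF]
  · rintro ⟨h1, h2⟩
    ext c
    rw [mem_dualH_comb, mem_combCode_H, ← h1, h2]
    simp
end

section
/- Let C = aC_a ⊕ bC_b be a linear code of length n over H_23, where C_a is a binary linear code and C_b a ternary linear code. Then C is LCD (i.e. C ∩ C^⊥ = {0}) if and only if C_a is an LCD binary code and C_b = {0}; moreover, in that case C is nice. -/
theorem card_mul_card_dualF {n : ℕ} (W : Submodule (ZMod 2) (Fin n → ZMod 2)) :
    Nat.card W * Nat.card (dualF (W : Set (Fin n → ZMod 2))) = 2 ^ n := by
  let B : LinearMap.BilinForm (ZMod 2) (Fin n → ZMod 2) := dotProductBilin (ZMod 2) (ZMod 2)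
  have hB : ∀ x y, B x y = x ⬝ᵥ y := fun x y => rfl
  have hker : W ⊓ LinearMap.ker B = ⊥ := by
    rw [eq_bot_iff]
    rintro x ⟨-, hx⟩
    have hx' : B x = 0 := hx
    have : x = 0 := by
      rw [← dotProduct_eq_zero_iff]
      intro y
      rw [← hB, hx']
      rfl
    simpa using this
  have h := LinearMap.BilinForm.finrank_add_finrank_orthogonal' (B := B) W
  rw [hker] at h
  simp only [finrank_bot, add_zero, Module.finrank_fin_fun] at h
  have hd : dualF (W : Set (Fin n → ZMod 2)) = (B.orthogonal W : Set (Fin n → ZMod 2)) := by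
    ext y
    rfl
  rw [hd]
  have h1 := Module.natCard_eq_pow_finrank (K := ZMod 2) (V := W)
  have h2 := Module.natCard_eq_pow_finrank (K := ZMod 2) (V := B.orthogonal W)
  rw [Nat.card_zmod] at h1 h2
  calc _ = Nat.card W * Nat.card (B.orthogonal W) := rfl
    _ = _ := by rw [h1, h2, ← pow_add, h]

theorem mem_combCode_iff {n : ℕ} (Ca : Set (Fin n → ZMod 2)) (Cb : Set (Fin n → ZMod 3))
    (c : Fin n → Hring) :
    c ∈ combCode Ca Cb ↔ (fun i => (c i).1) ∈ Ca ∧ (fun i => (c i).2) ∈ Cb := by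
  constructor
  · rintro ⟨x, hx, y, hy, rfl⟩
    constructor
    · simpa [aVec, bVec] using hx
    · simpa [aVec, bVec] using hy
  · rintro ⟨h1, h2⟩
    refine ⟨_, h1, _, h2, ?_⟩
    ext i <;> simp [aVec, bVec]

theorem mem_dualH_iff {n : ℕ} (Ca : Set (Fin n → ZMod 2)) (Cb : Set (Fin n → ZMod 3))
    (h0 : (0 : Fin n → ZMod 3) ∈ Cb) (c : Fin n → Hring) :
    c ∈ dualH mul23 (combCode Ca Cb) ↔ (fun i => (c i).1) ∈ dualF Ca := by
  constructor
  · intro h x hx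
    have := h (fun i => (x i, 0)) ((mem_combCode_iff _ _ _).2 ⟨hx, h0⟩)
    rw [innerH_mul23] at this
    exact congrArg Prod.fst this
  · intro h x hx
    rw [innerH_mul23, h _ ((mem_combCode_iff _ _ _).1 hx).1]
    rfl

/-- Splitting a vector over `H` into its two components. -/
def splitEquiv (n : ℕ) : (Fin n → Hring) ≃ (Fin n → ZMod 2) × (Fin n → ZMod 3) where
  toFun c := (fun i => (c i).1, fun i => (c i).2)
  invFun p := fun i => (p.1 i, p.2 i)
  left_inv _ := rfl
  right_inv _ := rfl

theorem card_split {n : ℕ} (S : Set (Fin n → Hring)) (A : Set (Fin n → ZMod 2))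
    (B : Set (Fin n → ZMod 3))
    (h : ∀ c, c ∈ S ↔ (fun i => (c i).1) ∈ A ∧ (fun i => (c i).2) ∈ B) :
    Nat.card S = Nat.card A * Nat.card B := by
  rw [← Nat.card_prod, ← Nat.card_congr (Equiv.Set.prod A B)]
  exact Nat.card_congr ((splitEquiv n).subtypeEquiv h)

/-- A code `C = a C_a ⊕ b C_b` over `H₂₃` is LCD iff `C_a` is an LCD
binary code and `C_b = {0}`; moreover, in that case `C` is nice (`|C|·|C^⊥| = 6^n`). -/
theorem lcd_iff_H23 {n : ℕ}
    (Ca : Submodule (ZMod 2) (Fin n → ZMod 2)) (Cb : Submodule (ZMod 3) (Fin n → ZMod 3)) :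
    (combCode (Ca : Set (Fin n → ZMod 2)) (Cb : Set (Fin n → ZMod 3)) ∩
          dualH mul23 (combCode (Ca : Set (Fin n → ZMod 2)) (Cb : Set (Fin n → ZMod 3))) =
          {0} ↔
        ((Ca : Set (Fin n → ZMod 2)) ∩ dualF (Ca : Set (Fin n → ZMod 2)) = {0} ∧
          (Cb : Set (Fin n → ZMod 3)) = {0})) ∧
      (combCode (Ca : Set (Fin n → ZMod 2)) (Cb : Set (Fin n → ZMod 3)) ∩
          dualH mul23 (combCode (Ca : Set (Fin n → ZMod 2)) (Cb : Set (Fin n → ZMod 3))) =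
          {0} →
        Nat.card (combCode (Ca : Set (Fin n → ZMod 2)) (Cb : Set (Fin n → ZMod 3))) *
          Nat.card (dualH mul23
            (combCode (Ca : Set (Fin n → ZMod 2)) (Cb : Set (Fin n → ZMod 3)))) = 6 ^ n) := by
  have h0 : (0 : Fin n → ZMod 3) ∈ (Cb : Set (Fin n → ZMod 3)) := Cb.zero_mem
  have h0a : (0 : Fin n → ZMod 2) ∈ (Ca : Set (Fin n → ZMod 2)) := Ca.zero_mem
  have h0d : (0 : Fin n → ZMod 2) ∈ dualF (Ca : Set (Fin n → ZMod 2)) := by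
    intro x _
    simp [innerF]
  have key : combCode (Ca : Set (Fin n → ZMod 2)) (Cb : Set (Fin n → ZMod 3)) ∩
          dualH mul23 (combCode (Ca : Set (Fin n → ZMod 2)) (Cb : Set (Fin n → ZMod 3))) =
          {0} ↔
        ((Ca : Set (Fin n → ZMod 2)) ∩ dualF (Ca : Set (Fin n → ZMod 2)) = {0} ∧
          (Cb : Set (Fin n → ZMod 3)) = {0}) := by
    constructor
    · intro h
      have h' : ∀ x ∈ Ca, x ∈ dualF (Ca : Set (Fin n → ZMod 2)) → ∀ y ∈ Cb,
          x = 0 ∧ y = 0 := by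
        intro x hx hxd y hy
        have hm : (fun i => (x i, y i) : Fin n → Hring) ∈ ({0} : Set (Fin n → Hring)) := by
          rw [← h]
          exact ⟨(mem_combCode_iff _ _ _).2 ⟨hx, hy⟩, (mem_dualH_iff _ _ h0 _).2 hxd⟩
        have hm' := Set.mem_singleton_iff.1 hm
        exact ⟨funext fun i => congrArg Prod.fst (congrFun hm' i),
          funext fun i => congrArg Prod.snd (congrFun hm' i)⟩
      constructor
      · ext x
        constructor
        · rintro ⟨hx, hxd⟩
          exact (h' x hx hxd 0 h0).1
        · rintro rfl
          exact ⟨h0a, h0d⟩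
      · ext y
        constructor
        · intro hy
          exact (h' 0 h0a h0d y hy).2
        · rintro rfl
          exact h0
    · rintro ⟨h1, h2⟩
      ext c
      constructor
      · rintro ⟨hc, hd⟩
        rw [mem_dualH_iff _ _ h0] at hd
        obtain ⟨hca, hcb⟩ := (mem_combCode_iff _ _ _).1 hc
        have e1 : (fun i => (c i).1) ∈ ({0} : Set (Fin n → ZMod 2)) := h1 ▸ ⟨hca, hd⟩
        rw [h2] at hcb
        exact funext fun i => Prod.ext (congrFun e1 i) (congrFun hcb i)
      · rintro rfl
        exact ⟨(mem_combCode_iff _ _ _).2 ⟨h0a, h0⟩, (mem_dualH_iff _ _ h0 _).2 h0d⟩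
  refine ⟨key, fun h => ?_⟩
  obtain ⟨-, h2⟩ := key.1 h
  rw [card_split _ _ _ (mem_combCode_iff _ _),
    card_split (dualH mul23 _) (dualF (Ca : Set (Fin n → ZMod 2))) Set.univ
      (fun c => by rw [mem_dualH_iff _ _ h0]; simp)]
  have hc := card_mul_card_dualF Ca
  have h3 : Nat.card (Cb : Set (Fin n → ZMod 3)) = 1 := by
    rw [h2]; simp
  have h4 : Nat.card (Set.univ : Set (Fin n → ZMod 3)) = 3 ^ n := by
    simp
  have h5 : Nat.card (Ca : Set (Fin n → ZMod 2)) = Nat.card Ca := rfl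
  rw [h3, h4, h5, mul_one, ← mul_assoc, hc, ← mul_pow]
  norm_num
end
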